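/- Let A be a real n×n N-matrix and let α be a nonempty proper subset of {1,…,n}. Then A[α] is invertible and the Schur complement A/A[α] = A[ᾱ] − A[ᾱ,α] A[α]⁻¹ A[α,ᾱ] is a P-matrix, where ᾱ = {1,…,n}∖α. -/

import Mathlib

open Matrix BigOperators

/-- A real matrix is an N-matrix if all of its principal minors are negative. -/
def IsNMatrix {m : Type*} [Fintype m] [DecidableEq m] (A : Matrix m m ℝ) : Prop :=
  ∀ α : Finset m, α.Nonempty →
    (A.submatrix (fun i : α => (i : m)) (fun j : α => (j : m))).det < 0

/-- A real matrix is a P-matrix if all of its principal minors are positive. -/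
def IsPMatrix {m : Type*} [Fintype m] [DecidableEq m] (A : Matrix m m ℝ) : Prop :=
  ∀ α : Finset m, α.Nonempty →
    0 < (A.submatrix (fun i : α => (i : m)) (fun j : α => (j : m))).det

/-- A principal minor indexed through an injection is negative. -/
lemma IsNMatrix.det_submatrix_neg {m ι : Type*} [Fintype m] [DecidableEq m]
    [Fintype ι] [DecidableEq ι] [Nonempty ι] {A : Matrix m m ℝ} (hA : IsNMatrix A)
    (f : ι → m) (hf : Function.Injective f) : (A.submatrix f f).det < 0 := by
  have h := hA (Finset.univ.image f) (Finset.univ_nonempty.image f)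
  let g : ι → (Finset.univ.image f : Finset m) :=
    fun i => ⟨f i, Finset.mem_image_of_mem f (Finset.mem_univ i)⟩
  have hg : Function.Bijective g := by
    constructor
    · intro a b hab
      exact hf (congrArg Subtype.val hab)
    · rintro ⟨x, hx⟩
      obtain ⟨i, _, rfl⟩ := Finset.mem_image.mp hx
      exact ⟨i, rfl⟩
  rw [← Matrix.det_submatrix_equiv_self (Equiv.ofBijective g hg)] at h
  exact h

/-- [N4]: if `A` is an N-matrix and `α` is a nonempty proper subset of indices,
then `A[α]` is invertible and the Schur complement `A/A[α]` is a P-matrix. -/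
theorem stmt_8 {n : ℕ} (A : Matrix (Fin n) (Fin n) ℝ) (hA : IsNMatrix A)
    (α : Finset (Fin n)) (hα : α.Nonempty) (hprop : α ≠ Finset.univ) :
    IsUnit (A.submatrix (fun i : α => (i : Fin n)) (fun j : α => (j : Fin n))).det ∧
    IsPMatrix (Matrix.of fun i j : {k : Fin n // k ∉ α} =>
      A (i : Fin n) (j : Fin n) -
        ∑ p : α, ∑ q : α,
          A (i : Fin n) (p : Fin n) *
            (A.submatrix (fun i : α => (i : Fin n)) (fun j : α => (j : Fin n)))⁻¹ p q *
            A (q : Fin n) (j : Fin n)) := by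
  have hneg := hA α hα
  have hu : IsUnit (A.submatrix (fun i : α => (i : Fin n)) (fun j : α => (j : Fin n))).det :=
    isUnit_iff_ne_zero.mpr hneg.ne
  refine ⟨hu, ?_⟩
  intro β hβ
  obtain ⟨b, hb⟩ := hβ
  have : Nonempty (α ⊕ β) := ⟨Sum.inr ⟨b, hb⟩⟩
  let f : α ⊕ β → Fin n := Sum.elim (fun i => (i : Fin n)) (fun j => ((j : {k // k ∉ α}) : Fin n))
  have hf : Function.Injective f := by
    refine Function.Injective.sumElim Subtype.val_injective
      (Subtype.val_injective.comp Subtype.val_injective) ?_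
    intro a c h
    exact c.1.2 (h ▸ a.2)
  have hd := hA.det_submatrix_neg f hf
  let _ := Matrix.invertibleOfIsUnitDet _ hu
  rw [← Matrix.fromBlocks_toBlocks (A.submatrix f f)] at hd
  have e : (A.submatrix f f).toBlocks₁₁ =
    A.submatrix (fun i : α => (i : Fin n)) (fun j : α => (j : Fin n)) := rfl
  rw [e, Matrix.det_fromBlocks₁₁] at hd
  have hp := pos_of_mul_neg_right hd hneg.le
  refine lt_of_lt_of_eq hp (congrArg Matrix.det ?_)
  symm
  ext i j
  simp only [Matrix.submatrix_apply, Matrix.of_apply, Matrix.sub_apply, Matrix.mul_apply,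
    Matrix.invOf_eq_nonsing_inv, Finset.sum_mul]
  rw [Finset.sum_comm]
  rfl
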